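/- arXiv:0810.0935 — 2 statements merged into one kernel-verified Lean document; each statement's English description precedes it below -/
import Mathlib

section
/- Let π : F₂ → H be a surjective group homomorphism with nontrivial kernel, and let L = {(u,v) ∈ F₂ × F₂ : π(u) = π(v)} be the Mihailova subgroup. Let ι : F₂ × F₂ → GL(4,ℤ) be the standard embedding, let L̄ = ι(L) be the image of L, a subgroup of GL(4,ℤ), and let h ∈ F₂ × F₂. Then the following are equivalent: (1) h ∈ L; (2) there exists g ∈ GL(4,ℤ) such that g⁻¹ L̄ g equals the subgroup of GL(4,ℤ) generated by L̄ ∪ {ι(h)}. -/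
/-- The Mihailova subgroup associated to a homomorphism `π : F₂ → H`:
`L = {(u,v) ∈ F₂ × F₂ : π(u) = π(v)}`. -/
def mihailova {H : Type*} [Group H] (π : FreeGroup (Fin 2) →* H) :
    Subgroup (FreeGroup (Fin 2) × FreeGroup (Fin 2)) where
  carrier := {p | π p.1 = π p.2}
  one_mem' := by simp
  mul_mem' := by
    intro a b ha hb
    simp only [Set.mem_setOf_eq, Prod.fst_mul, Prod.snd_mul, map_mul] at *
    rw [ha, hb]
  inv_mem' := by
    intro a ha
    simp only [Set.mem_setOf_eq, Prod.fst_inv, Prod.snd_inv, map_inv] at *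
    rw [ha]

/-- The matrix `S = [[1,2],[0,1]]` as an element of `GL(2,ℤ)`. -/
def Sgl : Matrix.GeneralLinearGroup (Fin 2) ℤ :=
  ⟨!![1, 2; 0, 1], !![1, -2; 0, 1],
    by norm_num [Matrix.mul_fin_two, ← Matrix.one_fin_two],
    by norm_num [Matrix.mul_fin_two, ← Matrix.one_fin_two]⟩

/-- The matrix `T = [[1,0],[2,1]]` as an element of `GL(2,ℤ)`. -/
def Tgl : Matrix.GeneralLinearGroup (Fin 2) ℤ :=
  ⟨!![1, 0; 2, 1], !![1, 0; -2, 1],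
    by norm_num [Matrix.mul_fin_two, ← Matrix.one_fin_two],
    by norm_num [Matrix.mul_fin_two, ← Matrix.one_fin_two]⟩

/-- The block-diagonal embedding of a pair of 2×2 integer matrices into 4×4 integer
matrices, as a ring homomorphism. -/
def blockDiagHom :
    (Matrix (Fin 2) (Fin 2) ℤ × Matrix (Fin 2) (Fin 2) ℤ) →+* Matrix (Fin 4) (Fin 4) ℤ where
  toFun p := Matrix.reindex finSumFinEquiv finSumFinEquiv (Matrix.fromBlocks p.1 0 0 p.2)
  map_one' := by
    simp [Matrix.fromBlocks_one, Matrix.reindex_apply, Matrix.submatrix_one_equiv]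
  map_mul' p q := by
    show Matrix.reindex finSumFinEquiv finSumFinEquiv (Matrix.fromBlocks (p * q).1 0 0 (p * q).2) =
      Matrix.reindex finSumFinEquiv finSumFinEquiv (Matrix.fromBlocks p.1 0 0 p.2) *
        Matrix.reindex finSumFinEquiv finSumFinEquiv (Matrix.fromBlocks q.1 0 0 q.2)
    rw [Matrix.reindex_apply, Matrix.reindex_apply, Matrix.reindex_apply,
      Matrix.submatrix_mul_equiv, Matrix.fromBlocks_multiply]
    simp
  map_zero' := by simp
  map_add' p q := by
    show Matrix.reindex finSumFinEquiv finSumFinEquiv (Matrix.fromBlocks (p + q).1 0 0 (p + q).2) =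
      Matrix.reindex finSumFinEquiv finSumFinEquiv (Matrix.fromBlocks p.1 0 0 p.2) +
        Matrix.reindex finSumFinEquiv finSumFinEquiv (Matrix.fromBlocks q.1 0 0 q.2)
    rw [Matrix.reindex_apply, Matrix.reindex_apply, Matrix.reindex_apply]
    ext i j
    rcases h1 : finSumFinEquiv.symm i with a | a <;> rcases h2 : finSumFinEquiv.symm j with b | b <;>
      simp [Matrix.submatrix_apply, h1, h2]

/-- The embedding `F₂ → GL(2,ℤ)` sending the two generators to `S` and `T`. -/
def rhoST : FreeGroup (Fin 2) →* Matrix.GeneralLinearGroup (Fin 2) ℤ :=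
  FreeGroup.lift ![Sgl, Tgl]

/-- The standard embedding `ι : F₂ × F₂ → GL(4,ℤ)`: on each factor the generators go to
`S` and `T` in `GL(2,ℤ)`, and the two factors are put in diagonal blocks. -/
def iotaSTD : FreeGroup (Fin 2) × FreeGroup (Fin 2) →* Matrix.GeneralLinearGroup (Fin 4) ℤ :=
  (Units.map blockDiagHom.toMonoidHom).comp
    ((MulEquiv.prodUnits.symm.toMonoidHom).comp (rhoST.prodMap rhoST))

theorem coe_rhoST_of_zero :
    (rhoST (FreeGroup.of 0) : Matrix (Fin 2) (Fin 2) ℤ) = !![1, 2; 0, 1] := by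
  simp [rhoST, Sgl]

theorem coe_rhoST_of_one :
    (rhoST (FreeGroup.of 1) : Matrix (Fin 2) (Fin 2) ℤ) = !![1, 0; 2, 1] := by
  simp [rhoST, Tgl]

/-- The inner product of the rows `i` and `j` of a matrix, used to
play ping-pong with left multiplication of `GL(2,ℤ)` on itself. -/
def rowGram (i j : Fin 2) (A : Matrix.GeneralLinearGroup (Fin 2) ℤ) : ℤ :=
  A i 0 * A j 0 + A i 1 * A j 1

theorem rowGram_self_nonneg (i : Fin 2) (A : Matrix.GeneralLinearGroup (Fin 2) ℤ) :
    0 ≤ rowGram i i A :=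
  add_nonneg (mul_self_nonneg _) (mul_self_nonneg _)

theorem not_rowGram_le_of_rowGram_le (A : Matrix.GeneralLinearGroup (Fin 2) ℤ)
    (h₁ : rowGram 1 1 A ≤ rowGram 0 1 A) : ¬ rowGram 0 0 A ≤ rowGram 0 1 A := by
  intro h₀
  have hdet : A 0 0 * A 1 1 - A 0 1 * A 1 0 ≠ 0 := by
    rw [← Matrix.det_fin_two]
    exact ((Matrix.isUnit_iff_isUnit_det _).1 A.isUnit).ne_zero
  simp only [rowGram] at h₀ h₁
  have h₂ : A 0 0 = A 1 0 := by
    nlinarith [sq_nonneg (A 0 0 - A 1 0), sq_nonneg (A 0 1 - A 1 1)]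
  have h₃ : A 0 1 = A 1 1 := by
    nlinarith [sq_nonneg (A 0 0 - A 1 0), sq_nonneg (A 0 1 - A 1 1)]
  exact hdet (by rw [h₂, h₃]; ring)

theorem not_rowGram_lt_neg_of_rowGram_lt_neg (A : Matrix.GeneralLinearGroup (Fin 2) ℤ)
    (h₁ : rowGram 0 1 A < -rowGram 1 1 A) : ¬ rowGram 0 1 A < -rowGram 0 0 A := by
  intro h₀
  simp only [rowGram] at h₀ h₁
  nlinarith [sq_nonneg (A 0 0 + A 1 0), sq_nonneg (A 0 1 + A 1 1)]

theorem rhoST_injective : Function.Injective rhoST := by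
  refine FreeGroup.injective_lift_of_ping_pong _
    (fun i ↦ {A : Matrix.GeneralLinearGroup (Fin 2) ℤ |
      rowGram (1 - i) (1 - i) A ≤ rowGram 0 1 A})
    (fun i ↦ {A | rowGram 0 1 A < -rowGram (1 - i) (1 - i) A}) ?_ ?_ ?_ ?_ ?_ ?_
  · intro i
    fin_cases i
    · exact ⟨Sgl, by simp [rowGram, Sgl]⟩
    · exact ⟨Tgl, by simp [rowGram, Tgl]⟩
  · intro i j hij
    refine Set.disjoint_left.2 fun A hi hj ↦ ?_
    fin_cases i <;> fin_cases j
    · exact hij rfl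
    · exact not_rowGram_le_of_rowGram_le A hi hj
    · exact not_rowGram_le_of_rowGram_le A hj hi
    · exact hij rfl
  · intro i j hij
    refine Set.disjoint_left.2 fun A hi hj ↦ ?_
    fin_cases i <;> fin_cases j
    · exact hij rfl
    · exact not_rowGram_lt_neg_of_rowGram_lt_neg A hi hj
    · exact not_rowGram_lt_neg_of_rowGram_lt_neg A hj hi
    · exact hij rfl
  · intro i j
    refine Set.disjoint_left.2 fun A hi hj ↦ ?_
    have h₁ := rowGram_self_nonneg (1 - i) A
    have h₂ := rowGram_self_nonneg (1 - j) A
    simp only [Set.mem_ofPred_eq] at hi hj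
    linarith
  · rintro i _ ⟨A, hA, rfl⟩
    simp only [Set.mem_compl_iff, Set.mem_ofPred_eq, not_lt] at hA ⊢
    fin_cases i <;>
      simp [rowGram, Sgl, Tgl, Matrix.mul_apply, Fin.sum_univ_two] at hA ⊢ <;>
      linarith
  · rintro i _ ⟨A, hA, rfl⟩
    simp only [Set.mem_compl_iff, Set.mem_ofPred_eq, not_le] at hA ⊢
    fin_cases i <;>
      simp [rowGram, Sgl, Tgl, Matrix.mul_apply, Fin.sum_univ_two, Units.inv_mk] at hA ⊢ <;>
      linarith

theorem coe_Sgl_zpow (k : ℤ) :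
    ((Sgl ^ k : Matrix.GeneralLinearGroup (Fin 2) ℤ) : Matrix (Fin 2) (Fin 2) ℤ) =
      !![1, 2 * k; 0, 1] := by
  induction k using Int.induction_on with
  | zero => simp [Matrix.one_fin_two]
  | succ k ih =>
    rw [zpow_add_one, Units.val_mul, ih]
    simp [Sgl]
    ring
  | pred k ih =>
    rw [zpow_sub_one, Units.val_mul, ih]
    simp [Sgl, Units.inv_mk]
    ring

/-- Sanov's sufficient criterion for membership in the image of `rhoST`. -/
theorem mem_range_rhoST_of_emod (A : Matrix.GeneralLinearGroup (Fin 2) ℤ)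
    (hdet : (A : Matrix (Fin 2) (Fin 2) ℤ).det = 1) (h₀₀ : A 0 0 % 4 = 1)
    (h₀₁ : A 0 1 % 2 = 0) (h₁₀ : A 1 0 % 2 = 0) : A ∈ rhoST.range := by
  have hS : Sgl ∈ rhoST.range := ⟨FreeGroup.of 0, by simp [rhoST]⟩
  have hT : Tgl ∈ rhoST.range := ⟨FreeGroup.of 1, by simp [rhoST]⟩
  induction hn : (A 0 0).natAbs + (A 1 0).natAbs using Nat.strong_induction_on generalizing A with
  | _ n ih =>
  have hred (B : Matrix.GeneralLinearGroup (Fin 2) ℤ) (hB : B ∈ rhoST.range)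
      (hBdet : (B : Matrix (Fin 2) (Fin 2) ℤ).det = 1) (hB₀₀ : (B * A) 0 0 % 4 = 1)
      (hB₀₁ : (B * A) 0 1 % 2 = 0) (hB₁₀ : (B * A) 1 0 % 2 = 0)
      (hlt : ((B * A) 0 0).natAbs + ((B * A) 1 0).natAbs < n) : A ∈ rhoST.range :=
    (Subgroup.mul_mem_cancel_left _ hB).1
      (ih _ hlt (B * A) (by simp [hBdet, hdet]) hB₀₀ hB₀₁ hB₁₀ rfl)
  rw [Matrix.det_fin_two] at hdet
  by_cases hc : A 1 0 = 0
  · rw [hc, mul_zero, sub_zero] at hdet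
    have ha : A 0 0 = 1 := by
      rcases Int.eq_one_or_neg_one_of_mul_eq_one hdet with h | h
      · exact h
      · rw [h] at h₀₀
        norm_num at h₀₀
    have hd : A 1 1 = 1 := by rwa [ha, one_mul] at hdet
    have hA : A = Sgl ^ (A 0 1 / 2) := by
      ext i j
      rw [coe_Sgl_zpow]
      fin_cases i <;> fin_cases j <;> simp [ha, hc, hd]
      omega
    rw [hA]
    exact zpow_mem hS _
  rcases lt_or_ge (A 0 0).natAbs (A 1 0).natAbs with hlt | hge
  · by_cases hsign : 0 < A 0 0 ↔ 0 < A 1 0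
    · refine hred Tgl⁻¹ (inv_mem hT) ?_ ?_ ?_ ?_ ?_ <;>
        simp [Tgl, Matrix.mul_apply, Fin.sum_univ_two, Units.inv_mk] <;> omega
    · refine hred Tgl hT ?_ ?_ ?_ ?_ ?_ <;>
        simp [Tgl, Matrix.mul_apply, Fin.sum_univ_two] <;> omega
  · by_cases hsign : 0 < A 0 0 ↔ 0 < A 1 0
    · refine hred Sgl⁻¹ (inv_mem hS) ?_ ?_ ?_ ?_ ?_ <;>
        simp [Sgl, Matrix.mul_apply, Fin.sum_univ_two, Units.inv_mk] <;> omega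
    · refine hred Sgl hS ?_ ?_ ?_ ?_ ?_ <;>
        simp [Sgl, Matrix.mul_apply, Fin.sum_univ_two] <;> omega

theorem exists_pow_mem_range_rhoST (A : Matrix.GeneralLinearGroup (Fin 2) ℤ) :
    ∃ k, 0 < k ∧ A ^ k ∈ rhoST.range := by
  let φ := Matrix.GeneralLinearGroup.map (n := Fin 2) (Int.castRingHom (ZMod 4))
  refine ⟨orderOf (φ A), orderOf_pos _, ?_⟩
  set B := A ^ orderOf (φ A) with hB
  have hone : φ B = 1 := by rw [hB, map_pow, pow_orderOf_eq_one]
  have hentry (i j) : ((B i j : ℤ) : ZMod 4) = (1 : Matrix (Fin 2) (Fin 2) (ZMod 4)) i j := by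
    have := congrArg (fun M : Matrix.GeneralLinearGroup (Fin 2) (ZMod 4) ↦ M i j) hone
    simpa [φ] using this
  have h₀₀ : B 0 0 % 4 = 1 := by
    simpa using (ZMod.intCast_eq_intCast_iff' (B 0 0) 1 4).1 (by simpa using hentry 0 0)
  have h₁₁ : B 1 1 % 4 = 1 := by
    simpa using (ZMod.intCast_eq_intCast_iff' (B 1 1) 1 4).1 (by simpa using hentry 1 1)
  have h₀₁ : B 0 1 % 4 = 0 := by
    simpa using (ZMod.intCast_eq_intCast_iff' (B 0 1) 0 4).1 (by simpa using hentry 0 1)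
  have h₁₀ : B 1 0 % 4 = 0 := by
    simpa using (ZMod.intCast_eq_intCast_iff' (B 1 0) 0 4).1 (by simpa using hentry 1 0)
  refine mem_range_rhoST_of_emod B ?_ h₀₀ (by omega) (by omega)
  have hmod : (B : Matrix (Fin 2) (Fin 2) ℤ).det % 4 = 1 := by
    simp [Matrix.det_fin_two, Int.sub_emod, Int.mul_emod, h₀₀, h₁₁, h₀₁]
  rcases Int.isUnit_iff.1 ((Matrix.isUnit_iff_isUnit_det _).1 B.isUnit) with h | h
  · exact h
  · rw [h] at hmod
    norm_num at hmod

theorem eq_zero_of_det_eq_zero_of_rhoST_mul {P : Matrix (Fin 2) (Fin 2) ℤ} (hdet : P.det = 0)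
    (hP : ∀ u, ∃ m : Matrix (Fin 2) (Fin 2) ℤ, (rhoST u : Matrix (Fin 2) (Fin 2) ℤ) * P = P * m) :
    P = 0 := by
  rw [Matrix.det_fin_two] at hdet
  obtain ⟨m, hm⟩ := hP (FreeGroup.of 0)
  obtain ⟨m', hm'⟩ := hP (FreeGroup.of 1)
  rw [coe_rhoST_of_zero] at hm
  rw [coe_rhoST_of_one] at hm'
  have e (i j) := congrFun₂ hm i j
  have e' (i j) := congrFun₂ hm' i j
  simp only [Matrix.mul_apply, Fin.sum_univ_two] at e e'
  have e₀₀ := e 0 0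
  have e₀₁ := e 0 1
  have e₁₀ := e 1 0
  have e₁₁ := e 1 1
  have e'₀₀ := e' 0 0
  have e'₀₁ := e' 0 1
  have e'₁₀ := e' 1 0
  have e'₁₁ := e' 1 1
  simp at e₀₀ e₀₁ e₁₀ e₁₁ e'₀₀ e'₀₁ e'₁₀ e'₁₁
  have hc : P 1 0 = 0 := by
    have : 2 * (P 1 0 * P 1 0) = 0 := by
      linear_combination P 1 0 * e₀₀ - P 0 0 * e₁₀ - m 1 0 * hdet
    simpa using this
  have hd : P 1 1 = 0 := by
    have : 2 * (P 1 1 * P 1 1) = 0 := by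
      linear_combination P 1 1 * e₀₁ - P 0 1 * e₁₁ + m 0 1 * hdet
    simpa using this
  have ha : P 0 0 = 0 := by
    have : 2 * (P 0 0 * P 0 0) = 0 := by
      linear_combination P 0 0 * e'₁₀ - P 1 0 * e'₀₀ + m' 1 0 * hdet
    simpa using this
  have hb : P 0 1 = 0 := by
    have : 2 * (P 0 1 * P 0 1) = 0 := by
      linear_combination P 0 1 * e'₁₁ - P 1 1 * e'₀₁ - m' 0 1 * hdet
    simpa using this
  ext i j
  fin_cases i <;> fin_cases j <;> assumption

theorem Subgroup.Normal.rhoST_mul_sub_eq_self {N : Subgroup (FreeGroup (Fin 2))} (hN : N.Normal)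
    (f : FreeGroup (Fin 2)) {X : Matrix (Fin 2) (Fin 2) ℤ}
    (hX : ∀ n ∈ N, (rhoST n : Matrix (Fin 2) (Fin 2) ℤ) * X = X) (n : FreeGroup (Fin 2))
    (hn : n ∈ N) :
    (rhoST n : Matrix (Fin 2) (Fin 2) ℤ) * (rhoST f * X - X) = rhoST f * X - X := by
  have hconj := hX (f⁻¹ * n * f) (by simpa using hN.conj_mem n hn f⁻¹)
  rw [Matrix.mul_sub, hX n hn]
  congr 1
  calc (rhoST n : Matrix (Fin 2) (Fin 2) ℤ) * (rhoST f * X)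
      = rhoST f * (rhoST (f⁻¹ * n * f) * X) := by
        rw [← Matrix.mul_assoc, ← Matrix.mul_assoc, ← Units.val_mul, ← Units.val_mul,
          ← map_mul, ← map_mul, mul_assoc f⁻¹, mul_inv_cancel_left]
    _ = rhoST f * X := by rw [hconj]

theorem Matrix.eq_one_of_mul_sub_eq_self {A R S T : Matrix (Fin 2) (Fin 2) ℤ}
    (hS : S = !![1, 2; 0, 1]) (hT : T = !![1, 0; 2, 1]) (hR : R ≠ 0)
    (h₁ : A * (S * R - R) = S * R - R) (h₂ : A * (T * R - R) = T * R - R)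
    (h₁₂ : A * (S * (T * R - R) - (T * R - R)) = S * (T * R - R) - (T * R - R))
    (h₂₁ : A * (T * (S * R - R) - (S * R - R)) = T * (S * R - R) - (S * R - R)) : A = 1 := by
  subst hS hT
  simp only [ne_eq, ← Matrix.ext_iff, Matrix.mul_apply, Matrix.sub_apply, Fin.sum_univ_two,
    Fin.forall_fin_two] at *
  simp [mul_left_eq_self₀] at *
  grind

theorem eq_zero_of_rhoST_mul_eq_self {N : Subgroup (FreeGroup (Fin 2))} [hNormal : N.Normal]
    (hN : N ≠ ⊥) {R : Matrix (Fin 2) (Fin 2) ℤ}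
    (hR : ∀ n ∈ N, (rhoST n : Matrix (Fin 2) (Fin 2) ℤ) * R = R) : R = 0 := by
  obtain ⟨n, hn, hn₁⟩ := N.bot_or_exists_ne_one.resolve_left hN
  by_contra hR₀
  refine hn₁ (rhoST_injective ?_)
  have hS := hNormal.rhoST_mul_sub_eq_self (.of 0) hR
  have hT := hNormal.rhoST_mul_sub_eq_self (.of 1) hR
  rw [map_one, Units.ext_iff]
  exact Matrix.eq_one_of_mul_sub_eq_self coe_rhoST_of_zero coe_rhoST_of_one hR₀
    (hS n hn) (hT n hn) (hNormal.rhoST_mul_sub_eq_self (.of 0) hT n hn)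
    (hNormal.rhoST_mul_sub_eq_self (.of 1) hS n hn)

theorem iotaSTD_mul_eq_iff {g : Matrix.GeneralLinearGroup (Fin 4) ℤ}
    {P Q R T : Matrix (Fin 2) (Fin 2) ℤ}
    (hg : (g : Matrix (Fin 4) (Fin 4) ℤ) =
      Matrix.reindex finSumFinEquiv finSumFinEquiv (Matrix.fromBlocks P Q R T))
    (l m : FreeGroup (Fin 2) × FreeGroup (Fin 2)) :
    iotaSTD l * g = g * iotaSTD m ↔
      (rhoST l.1 * P = P * rhoST m.1 ∧ rhoST l.1 * Q = Q * rhoST m.2) ∧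
        rhoST l.2 * R = R * rhoST m.1 ∧ rhoST l.2 * T = T * rhoST m.2 := by
  have hiota (p : FreeGroup (Fin 2) × FreeGroup (Fin 2)) :
      (iotaSTD p : Matrix (Fin 4) (Fin 4) ℤ) = Matrix.reindex finSumFinEquiv finSumFinEquiv
        (Matrix.fromBlocks (rhoST p.1).val 0 0 (rhoST p.2).val) := rfl
  rw [Units.ext_iff, Units.val_mul, Units.val_mul, hg, hiota, hiota]
  simp only [Matrix.reindex_apply, Matrix.submatrix_mul_equiv, Matrix.fromBlocks_multiply]
  rw [← Matrix.reindex_apply, ← Matrix.reindex_apply, EmbeddingLike.apply_eq_iff_eq,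
    Matrix.fromBlocks_inj]
  simp [and_assoc]

theorem Matrix.eq_one_of_mul_eq_self_of_det_ne_zero {P m : Matrix (Fin 2) (Fin 2) ℤ}
    (hP : P.det ≠ 0) (h : P = P * m) : m = 1 := by
  have := congrArg (P.adjugate * ·) h
  simp only [← Matrix.mul_assoc, Matrix.adjugate_mul, Matrix.smul_mul, Matrix.one_mul] at this
  exact (smul_right_injective _ hP this).symm

/-- A matrix in `GL(4,ℤ)` conjugating the image of a Mihailova subgroup into the image of
`F₂ × F₂` is block diagonal or block antidiagonal. -/
theorem offDiag_eq_zero_or_diag_eq_zero {N : Subgroup (FreeGroup (Fin 2))} [N.Normal]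
    (hN : N ≠ ⊥) {L : Subgroup (FreeGroup (Fin 2) × FreeGroup (Fin 2))}
    (hdiag : ∀ u, (u, u) ∈ L) (hleft : ∀ n ∈ N, (n, 1) ∈ L) (hright : ∀ n ∈ N, (1, n) ∈ L)
    {g : Matrix.GeneralLinearGroup (Fin 4) ℤ} {P Q R T P' Q' R' T' : Matrix (Fin 2) (Fin 2) ℤ}
    (hg : (g : Matrix (Fin 4) (Fin 4) ℤ) =
      Matrix.reindex finSumFinEquiv finSumFinEquiv (Matrix.fromBlocks P Q R T))
    (hinv : Matrix.fromBlocks P Q R T * Matrix.fromBlocks P' Q' R' T' = 1)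
    (hconj : ∀ l ∈ L, ∃ m, iotaSTD l * g = g * iotaSTD m) :
    (Q = 0 ∧ R = 0) ∨ (P = 0 ∧ T = 0) := by
  simp only [iotaSTD_mul_eq_iff hg] at hconj
  rw [← Matrix.fromBlocks_one] at hinv
  rw [Matrix.fromBlocks_multiply, Matrix.fromBlocks_inj] at hinv
  by_cases hP : P.det = 0
  · right
    have hP₀ : P = 0 := eq_zero_of_det_eq_zero_of_rhoST_mul hP fun u ↦
      let ⟨m, hm⟩ := hconj _ (hdiag u)
      ⟨_, hm.1.1⟩
    subst hP₀
    refine ⟨rfl, eq_zero_of_rhoST_mul_eq_self hN fun n hn ↦ ?_⟩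
    obtain ⟨m, ⟨-, hQ⟩, -, hT⟩ := hconj _ (hright n hn)
    have hQ' : Q.det ≠ 0 := by
      refine ((Matrix.isUnit_iff_isUnit_det Q).1 (IsUnit.of_mul_eq_one R' ?_)).ne_zero
      simpa using hinv.1
    have hm : (rhoST m.2).val = 1 :=
      Matrix.eq_one_of_mul_eq_self_of_det_ne_zero hQ' (by simpa using hQ)
    rw [hT, hm, mul_one]
  · left
    have hR : R = 0 := eq_zero_of_rhoST_mul_eq_self hN fun n hn ↦ by
      obtain ⟨m, ⟨hP', -⟩, hR, -⟩ := hconj _ (hright n hn)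
      have hm : (rhoST m.1).val = 1 :=
        Matrix.eq_one_of_mul_eq_self_of_det_ne_zero hP (by simpa using hP')
      rw [hR, hm, mul_one]
    subst hR
    refine ⟨eq_zero_of_rhoST_mul_eq_self hN fun n hn ↦ ?_, rfl⟩
    obtain ⟨m, ⟨-, hQ⟩, -, hT⟩ := hconj _ (hleft n hn)
    have hT' : T.det ≠ 0 := by
      refine ((Matrix.isUnit_iff_isUnit_det T).1 (IsUnit.of_mul_eq_one T' ?_)).ne_zero
      simpa using hinv.2.2.2
    have hm : (rhoST m.2).val = 1 :=
      Matrix.eq_one_of_mul_eq_self_of_det_ne_zero hT' (by simpa using hT)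
    rw [hQ, hm, mul_one]

theorem exists_conj_rhoST_mem {N : Subgroup (FreeGroup (Fin 2))} [N.Normal]
    (hN : N ≠ ⊥) {L : Subgroup (FreeGroup (Fin 2) × FreeGroup (Fin 2))}
    (hdiag : ∀ u, (u, u) ∈ L) (hleft : ∀ n, n ∈ N ↔ (n, 1) ∈ L) (hright : ∀ n, n ∈ N ↔ (1, n) ∈ L)
    {g : Matrix.GeneralLinearGroup (Fin 4) ℤ}
    (hconj : ∀ l ∈ L, ∃ m, iotaSTD l * g = g * iotaSTD m) :
    ∃ A : Matrix.GeneralLinearGroup (Fin 2) ℤ, ∀ x, ∀ l ∈ L,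
      iotaSTD l * g = g * iotaSTD (x, 1) → ∃ n ∈ N, rhoST n = A * rhoST x * A⁻¹ := by
  let e := Matrix.reindex (α := ℤ) (finSumFinEquiv (m := 2) (n := 2))
    (finSumFinEquiv (m := 2) (n := 2))
  obtain ⟨M, hg⟩ := e.surjective g.val
  obtain ⟨M', hg'⟩ := e.surjective g⁻¹.val
  have hinv : M * M' = 1 := by
    apply e.injective
    have hmul : e M * e M' = 1 := by
      rw [hg, hg']
      exact g.mul_inv
    simpa [e, Matrix.submatrix_mul_equiv] using hmul
  rw [← Matrix.fromBlocks_toBlocks M] at hg hinv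
  rw [← Matrix.fromBlocks_toBlocks M'] at hinv
  have hcases := offDiag_eq_zero_or_diag_eq_zero hN hdiag (fun n ↦ (hleft n).1)
    (fun n ↦ (hright n).1) hg.symm hinv hconj
  rw [← Matrix.fromBlocks_one, Matrix.fromBlocks_multiply, Matrix.fromBlocks_inj] at hinv
  rcases hcases with ⟨hQ, hR⟩ | ⟨hP, hT⟩
  · rw [hQ, hR] at hinv
    simp only [Matrix.zero_mul, add_zero, zero_add] at hinv
    obtain ⟨A, hA⟩ := IsUnit.of_mul_eq_one _ hinv.1
    obtain ⟨B, hB⟩ := IsUnit.of_mul_eq_one _ hinv.2.2.2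
    refine ⟨A, fun x l hl hlx ↦ ?_⟩
    obtain ⟨⟨h₁, -⟩, -, h₂⟩ := (iotaSTD_mul_eq_iff hg.symm _ _).1 hlx
    rw [← hA, ← Units.val_mul, ← Units.val_mul, ← Units.ext_iff] at h₁
    rw [← hB, ← Units.val_mul, ← Units.val_mul, ← Units.ext_iff] at h₂
    have hl₂ : l.2 = 1 := rhoST_injective (by simpa using h₂)
    exact ⟨l.1, (hleft _).2 (by rwa [← hl₂]), eq_mul_inv_of_mul_eq h₁⟩
  · rw [hP, hT] at hinv
    simp only [Matrix.zero_mul, add_zero, zero_add] at hinv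
    obtain ⟨B, hB⟩ := IsUnit.of_mul_eq_one _ hinv.1
    obtain ⟨A, hA⟩ := IsUnit.of_mul_eq_one _ hinv.2.2.2
    refine ⟨A, fun x l hl hlx ↦ ?_⟩
    obtain ⟨⟨-, h₂⟩, h₁, -⟩ := (iotaSTD_mul_eq_iff hg.symm _ _).1 hlx
    rw [← hA, ← Units.val_mul, ← Units.val_mul, ← Units.ext_iff] at h₁
    rw [← hB, ← Units.val_mul, ← Units.val_mul, ← Units.ext_iff] at h₂
    have hl₁ : l.1 = 1 := rhoST_injective (by simpa using h₂)
    exact ⟨l.2, (hright _).2 (by rwa [← hl₁]), eq_mul_inv_of_mul_eq h₁⟩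

theorem mem_of_conj_rhoST_mem {N : Subgroup (FreeGroup (Fin 2))} [hNormal : N.Normal]
    {A : Matrix.GeneralLinearGroup (Fin 2) ℤ}
    (hA : ∀ n ∈ N, ∃ n' ∈ N, rhoST n' = A * rhoST n * A⁻¹) {x : FreeGroup (Fin 2)}
    (hx : ∃ n ∈ N, rhoST n = A * rhoST x * A⁻¹) : x ∈ N := by
  obtain ⟨k, hk, f, hf⟩ := exists_pow_mem_range_rhoST A
  have hpow (j : ℕ) : ∃ n ∈ N, rhoST n = A ^ (j + 1) * rhoST x * (A ^ (j + 1))⁻¹ := by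
    induction j with
    | zero => simpa using hx
    | succ j ih =>
      obtain ⟨n, hn, hnx⟩ := ih
      obtain ⟨n', hn', hnn'⟩ := hA n hn
      refine ⟨n', hn', ?_⟩
      rw [hnn', hnx, pow_succ' A (j + 1)]
      group
  obtain ⟨n, hn, hnx⟩ := hpow (k - 1)
  rw [Nat.sub_add_cancel hk, ← hf, ← map_inv, ← map_mul, ← map_mul] at hnx
  rw [rhoST_injective hnx] at hn
  simpa using hNormal.mem_comm hn

theorem mem_mihailova_iff_conjugate (H : Type*) [Group H] (π : FreeGroup (Fin 2) →* H)
    (hπ : Function.Surjective π) (hker : π.ker ≠ ⊥)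
    (h : FreeGroup (Fin 2) × FreeGroup (Fin 2)) :
    h ∈ mihailova π ↔
      ∃ g : Matrix.GeneralLinearGroup (Fin 4) ℤ,
        Subgroup.map (MulAut.conj g⁻¹).toMonoidHom ((mihailova π).map iotaSTD) =
          Subgroup.closure
            (((mihailova π).map iotaSTD : Set (Matrix.GeneralLinearGroup (Fin 4) ℤ)) ∪
              {iotaSTD h}) := by
  have hmem (p : FreeGroup (Fin 2) × FreeGroup (Fin 2)) : p ∈ mihailova π ↔ π p.1 = π p.2 :=
    Iff.rfl
  constructor
  · intro hh
    refine ⟨1, ?_⟩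
    rw [Set.union_eq_self_of_subset_right
      (Set.singleton_subset_iff.2 (Subgroup.mem_map_of_mem iotaSTD hh)), Subgroup.closure_eq]
    ext x
    simp
  · rintro ⟨g, hg⟩
    set K := Subgroup.closure
      (((mihailova π).map iotaSTD : Set (Matrix.GeneralLinearGroup (Fin 4) ℤ)) ∪ {iotaSTD h})
      with hK
    have hLK (l) (hl : l ∈ mihailova π) : iotaSTD l ∈ K :=
      Subgroup.subset_closure (Or.inl (Subgroup.mem_map_of_mem iotaSTD hl))
    have hKrange : K ≤ iotaSTD.range := by
      rw [hK, Subgroup.closure_le]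
      rintro _ (⟨l, -, rfl⟩ | rfl)
      exacts [⟨l, rfl⟩, ⟨h, rfl⟩]
    have hconj (l) (hl : l ∈ mihailova π) : ∃ m, iotaSTD l * g = g * iotaSTD m := by
      have hgl : g⁻¹ * iotaSTD l * g ∈ K := by
        rw [← hg]
        exact ⟨_, Subgroup.mem_map_of_mem iotaSTD hl, by simp⟩
      obtain ⟨m, hm⟩ := hKrange hgl
      exact ⟨m, by rw [hm]; group⟩
    obtain ⟨A, hA⟩ := exists_conj_rhoST_mem hker (fun u ↦ (hmem (u, u)).2 rfl)
      (fun n ↦ by simp [hmem, MonoidHom.mem_ker])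
      (fun n ↦ by simp [hmem, MonoidHom.mem_ker, eq_comm]) hconj
    have hAK (x) (hx : iotaSTD (x, 1) ∈ K) : ∃ n ∈ π.ker, rhoST n = A * rhoST x * A⁻¹ := by
      rw [← hg] at hx
      obtain ⟨_, ⟨l, hl, rfl⟩, hlx⟩ := hx
      refine hA x l hl ?_
      rw [← hlx]
      simp [mul_assoc]
    have hquot : h.1 * h.2⁻¹ ∈ π.ker := by
      refine mem_of_conj_rhoST_mem
        (fun n hn ↦ hAK n (hLK _ (by simpa [hmem, MonoidHom.mem_ker] using hn))) (hAK _ ?_)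
      have hsplit : (h.1 * h.2⁻¹, (1 : FreeGroup (Fin 2))) = h * (h.2, h.2)⁻¹ := by
        ext <;> simp
      rw [hsplit, map_mul, map_inv]
      exact mul_mem (Subgroup.subset_closure (Or.inr rfl)) (inv_mem (hLK _ rfl))
    rw [hmem]
    simpa [MonoidHom.mem_ker, mul_inv_eq_one] using hquot
end

section
/- Let π : F₂ → H be a surjective group homomorphism with nontrivial kernel, let L = {(u,v) ∈ F₂ × F₂ : π(u) = π(v)} be the Mihailova subgroup, let ι : F₂ × F₂ → GL(4,ℤ) be the standard embedding, and let L̄ = ι(L). Fix p ≥ 1 and elements h₁, …, h_p ∈ GL(4,ℤ) such that the subgroup of GL(4,ℤ) generated by {h₁, …, h_p} equals L̄. For h ∈ F₂ × F₂, let G_h be the semidirect product ℤ⁴ ⋊ FreeGroup (Fin (p+1)) in which the generators x_0, …, x_{p-1} act on ℤ⁴ by the matrices h₁, …, h_p and the last generator x_p acts by ι(h), and let G_1 be the semidirect product defined the same way but with x_p acting by the identity. Then h ∈ L if and only if G_h and G_1 are isomorphic as groups. -/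
/-- The group automorphism of `ℤ⁴` (written multiplicatively) determined by an element of
`GL(4,ℤ)` acting `ℤ`-linearly on `ℤ⁴ = Fin 4 → ℤ`. -/
def glAut (g : Matrix.GeneralLinearGroup (Fin 4) ℤ) :
    MulAut (Multiplicative (Fin 4 → ℤ)) :=
  AddEquiv.toMultiplicative
    ((LinearMap.GeneralLinearGroup.generalLinearEquiv ℤ (Fin 4 → ℤ)
      (Matrix.GeneralLinearGroup.toLin g)).toAddEquiv)

/-- The action of `FreeGroup (Fin (p+1))` on `ℤ⁴` in which the generator `x_i` for `i < p`
acts by the matrix `hs i`, and the last generator `x_p` acts by the matrix `k`. -/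
def actionOf (p : ℕ) (hs : Fin p → Matrix.GeneralLinearGroup (Fin 4) ℤ)
    (k : MulAut (Multiplicative (Fin 4 → ℤ))) :
    FreeGroup (Fin (p + 1)) →* MulAut (Multiplicative (Fin 4 → ℤ)) :=
  FreeGroup.lift (fun i : Fin (p + 1) =>
    if hi : (i : ℕ) < p then glAut (hs ⟨i, hi⟩) else k)

namespace FreeGroup

variable {α : Type*} [DecidableEq α]

/-- A nontrivial element does not commute with its conjugate by a generator different from those of
its first and last letters. -/
theorem not_commute_conj_of {w : FreeGroup α} {a b : α × Bool} {y : α}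
    (ha : a ∈ w.toWord.head?) (hb : b ∈ w.toWord.getLast?) (hya : y ≠ a.1) (hyb : y ≠ b.1) :
    ¬ Commute w (of y * w * (of y)⁻¹) := by
  intro hc
  have hred : IsReduced w.toWord := isReduced_toWord
  have hleft : IsReduced (w.toWord ++ ([(y, true)] ++ (w.toWord ++ [(y, false)]))) := by
    unfold IsReduced at *
    simp only [List.isChain_append]
    simp [List.head?_append, hred, Option.mem_def.mp ha, Option.mem_def.mp hb, hya, hyb.symm]
  have hright : IsReduced ([(y, true)] ++ (w.toWord ++ ([(y, false)] ++ w.toWord))) := by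
    unfold IsReduced at *
    simp only [List.isChain_append]
    simp [List.head?_append, hred, Option.mem_def.mp ha, Option.mem_def.mp hb, hya, hyb.symm]
  have h1 : w * (of y * w * (of y)⁻¹) =
      mk (w.toWord ++ ([(y, true)] ++ (w.toWord ++ [(y, false)]))) := by
    simp only [← mul_mk, mk_toWord, mul_assoc]; rfl
  have h2 : (of y * w * (of y)⁻¹) * w =
      mk ([(y, true)] ++ (w.toWord ++ ([(y, false)] ++ w.toWord))) := by
    simp only [← mul_mk, mk_toWord, mul_assoc]; rfl
  have h3 := congrArg toWord hc.eq
  rw [h1, h2, toWord_mk, toWord_mk, hleft.reduce_eq, hright.reduce_eq] at h3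
  have h4 := congrArg List.head? h3
  simp only [Option.mem_def] at ha
  simp only [List.head?_append, ha, List.head?_cons, Option.or_some, Option.getD_some,
    Option.some.injEq] at h4
  exact hya (by rw [h4])

/-- Over at least two generators, an element all of whose conjugates commute is trivial. -/
theorem eq_one_of_forall_commute_conj [Nontrivial α] {w : FreeGroup α}
    (hw : ∀ g k : FreeGroup α, Commute (g * w * g⁻¹) (k * w * k⁻¹)) : w = 1 := by
  by_contra hne
  rw [← toWord_eq_nil_iff] at hne
  obtain ⟨a, ha⟩ : ∃ a, a ∈ w.toWord.head? := ⟨_, List.head?_eq_some_head hne⟩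
  obtain ⟨b, hb⟩ : ∃ b, b ∈ w.toWord.getLast? := ⟨_, List.getLast?_eq_some_getLast hne⟩
  obtain ⟨y, hy⟩ := exists_ne a.1
  by_cases hab : a.1 = b.1
  · exact not_commute_conj_of ha hb hy (hab ▸ hy) (by simpa using hw 1 (of y))
  · have hred : IsReduced w.toWord := isReduced_toWord
    have hconj : IsReduced ([a] ++ (w.toWord ++ [(a.1, !a.2)])) := by
      unfold IsReduced at *
      simp only [List.isChain_append]
      simp [List.head?_append, hred, Option.mem_def.mp ha, Option.mem_def.mp hb, Ne.symm hab]
    have heq : mk [a] * w * (mk [a])⁻¹ = mk ([a] ++ (w.toWord ++ [(a.1, !a.2)])) := by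
      simp only [← mul_mk, mk_toWord, mul_assoc]; rfl
    have hword : (mk [a] * w * (mk [a])⁻¹).toWord = [a] ++ (w.toWord ++ [(a.1, !a.2)]) := by
      rw [heq, toWord_mk, hconj.reduce_eq]
    refine not_commute_conj_of (w := mk [a] * w * (mk [a])⁻¹) (a := a) (b := (a.1, !a.2)) (y := y)
      (by rw [hword]; simp)
      (by rw [hword, ← List.append_assoc, List.getLast?_concat]; rfl) hy hy ?_
    have := hw (mk [a]) (of y * mk [a])
    simpa [mul_assoc] using this

end FreeGroup

open SemidirectProduct in
/-- An isomorphism between semidirect products of an abelian group by a nonabelian free group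
preserves the abelian normal factor. -/
theorem SemidirectProduct.right_mulEquiv_inl {α N : Type*} [Nontrivial α] [CommGroup N]
    {θ ψ : FreeGroup α →* MulAut N} (φ : N ⋊[θ] FreeGroup α ≃* N ⋊[ψ] FreeGroup α) (n : N) :
    (φ (inl n)).right = 1 := by
  classical
  refine FreeGroup.eq_one_of_forall_commute_conj fun g k => ?_
  have key : ∀ g : FreeGroup α, ∃ m : N, (φ (inl m)).right = g * (φ (inl n)).right * g⁻¹ := by
    intro g
    obtain ⟨x, hx⟩ := φ.surjective (inr g)
    refine ⟨(x * inl n * x⁻¹).left, ?_⟩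
    have : inl (x * inl n * x⁻¹).left = x * inl n * x⁻¹ := by
      ext <;> simp
    rw [this]
    simp [hx]
  obtain ⟨m, hm⟩ := key g
  obtain ⟨m', hm'⟩ := key k
  rw [← hm, ← hm', commute_iff_eq, ← mul_right, ← mul_right, ← map_mul, ← map_mul, ← map_mul,
    ← map_mul, mul_comm]

open SemidirectProduct in
/-- Isomorphic semidirect products of an abelian group by a nonabelian free group have
conjugate images of the acting groups. -/
theorem SemidirectProduct.exists_mulAut_conj_of_mulEquiv {α N : Type*} [Nontrivial α]
    [CommGroup N] {θ ψ : FreeGroup α →* MulAut N}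
    (φ : N ⋊[θ] FreeGroup α ≃* N ⋊[ψ] FreeGroup α) :
    ∃ A : MulAut N, ∀ f, A * θ f * A⁻¹ ∈ ψ.range := by
  have hφ : ∀ n, inl (φ (inl n)).left = φ (inl n) := fun n => by
    ext <;> simp [right_mulEquiv_inl φ n]
  have hφ' : ∀ n, inl (φ.symm (inl n)).left = φ.symm (inl n) := fun n => by
    ext <;> simp [right_mulEquiv_inl φ.symm n]
  let A : MulAut N :=
    { toFun := fun n => (φ (inl n)).left
      invFun := fun n => (φ.symm (inl n)).left
      left_inv := fun n => by simp [hφ]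
      right_inv := fun n => by simp [hφ']
      map_mul' := fun m n => by
        apply inl_injective (φ := ψ)
        rw [hφ, map_mul inl, map_mul inl, map_mul, hφ, hφ] }
  have hA : ∀ n, inl (A n) = φ (inl n) := hφ
  refine ⟨A, fun f => ⟨(φ (inr f)).right, ?_⟩⟩
  rw [eq_mul_inv_iff_mul_eq]
  ext n
  apply inl_injective (φ := ψ)
  have hconj : ∀ (x : N ⋊[ψ] FreeGroup α) (m : N), inl (ψ x.right m) = x * inl m * x⁻¹ := by
    intro x m
    ext <;> simp [mul_comm, mul_left_comm]
  simp only [MulAut.mul_apply]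
  rw [hconj, hA, hA, inl_aut]
  simp

theorem Matrix.GeneralLinearGroup.mul_apply_fin_two
    (a g : Matrix.GeneralLinearGroup (Fin 2) ℤ) (i j : Fin 2) :
    (a * g) i j = a i 0 * g 0 j + a i 1 * g 1 j := by
  simp [Matrix.mul_apply]

theorem coe_Tgl_zpow (k : ℤ) : (Tgl ^ k).val = !![1, 0; 2 * k, 1] := by
  induction k using Int.induction_on with
  | zero => simp [Matrix.one_fin_two]
  | succ k ih =>
    rw [zpow_add_one, Units.val_mul, ih]
    simp [Tgl, mul_add]
  | pred k ih =>
    rw [zpow_sub_one, Units.val_mul, ih]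
    simp [Tgl]
    ring

/-- Sanov's description of the subgroup generated by `S` and `T`. -/
theorem mem_range_rhoST (g : Matrix.GeneralLinearGroup (Fin 2) ℤ) (hdet : g.val.det = 1)
    (h00 : (4 : ℤ) ∣ g 0 0 - 1) (h01 : (2 : ℤ) ∣ g 0 1) (h10 : (2 : ℤ) ∣ g 1 0) :
    g ∈ rhoST.range := by
  have hS : Sgl ∈ rhoST.range := ⟨FreeGroup.of 0, by simp [rhoST]⟩
  have hT : Tgl ∈ rhoST.range := ⟨FreeGroup.of 1, by simp [rhoST]⟩
  induction hn : (g 0 0).natAbs + (g 0 1).natAbs using Nat.strong_induction_on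
    generalizing g with
  | _ n ih =>
  have step : ∀ s ∈ rhoST.range, s.val.det = 1 → (4 : ℤ) ∣ (g * s) 0 0 - 1 →
      (2 : ℤ) ∣ (g * s) 0 1 → (2 : ℤ) ∣ (g * s) 1 0 →
      ((g * s) 0 0).natAbs + ((g * s) 0 1).natAbs < n → g ∈ rhoST.range := by
    intro s hs hsdet h1 h2 h3 hlt
    have := ih _ hlt (g * s) (by rw [Units.val_mul, Matrix.det_mul, hdet, hsdet, one_mul])
      h1 h2 h3 rfl
    exact (Subgroup.mul_mem_cancel_right _ hs).mp this
  have hSdet : Sgl.val.det = 1 := by simp [Sgl, Matrix.det_fin_two]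
  have hTdet : Tgl.val.det = 1 := by simp [Tgl, Matrix.det_fin_two]
  have hSdet' : Sgl⁻¹.val.det = 1 := by simp [Sgl, Matrix.det_fin_two]
  have hTdet' : Tgl⁻¹.val.det = 1 := by simp [Tgl, Matrix.det_fin_two]
  by_cases hb : g 0 1 = 0
  · have hd := hdet
    rw [Matrix.det_fin_two, hb, zero_mul, sub_zero] at hd
    have h1 : g 0 0 = 1 := by
      rcases Int.eq_one_or_neg_one_of_mul_eq_one hd with h | h <;> omega
    obtain ⟨k, hk⟩ := h10
    have : g = Tgl ^ k := by
      apply Units.ext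
      rw [coe_Tgl_zpow]
      rw [h1, one_mul] at hd
      rw [Matrix.eta_fin_two g.val, h1, hb, hk, hd]
    rw [this]
    exact zpow_mem hT k
  · rcases lt_or_ge (g 0 1).natAbs (g 0 0).natAbs with hlt | hge
    · by_cases hsign : 0 < g 0 0 ↔ 0 < g 0 1
      · refine step _ (inv_mem hT) hTdet' ?_ ?_ ?_ ?_ <;>
          simp [Matrix.GeneralLinearGroup.mul_apply_fin_two, Tgl] <;> omega
      · refine step _ hT hTdet ?_ ?_ ?_ ?_ <;>
          simp [Matrix.GeneralLinearGroup.mul_apply_fin_two, Tgl] <;> omega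
    · by_cases hsign : 0 < g 0 0 ↔ 0 < g 0 1
      · refine step _ (inv_mem hS) hSdet' ?_ ?_ ?_ ?_ <;>
          simp [Matrix.GeneralLinearGroup.mul_apply_fin_two, Sgl] <;> omega
      · refine step _ hS hSdet ?_ ?_ ?_ ?_ <;>
          simp [Matrix.GeneralLinearGroup.mul_apply_fin_two, Sgl] <;> omega

theorem det_rhoST (w : FreeGroup (Fin 2)) : (rhoST w).val.det = 1 := by
  have h : Matrix.GeneralLinearGroup.det.comp rhoST = 1 := by
    ext i
    fin_cases i <;> simp [rhoST, Sgl, Tgl, Matrix.det_fin_two]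
  have := congrArg Units.val (DFunLike.congr_fun h w)
  simpa using this

/-- A nontrivial normal subgroup contains an element whose image is not unipotent. -/
theorem exists_mem_trace_rhoST_ne_two {K : Subgroup (FreeGroup (Fin 2))} [K.Normal]
    (hK : K ≠ ⊥) : ∃ n ∈ K, (rhoST n).val.trace ≠ 2 := by
  obtain ⟨w, hwK, hw⟩ := K.bot_or_exists_ne_one.resolve_left hK
  by_contra! hall
  have hne : rhoST w ≠ 1 := fun h => hw (rhoST_injective (h.trans (map_one _).symm))
  have hdet := det_rhoST w
  have htr := hall w hwK
  have hconj : ∀ i, (rhoST (w * (FreeGroup.of i * w * (FreeGroup.of i)⁻¹))).val.trace = 2 :=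
    fun i => hall _ (K.mul_mem hwK (Subgroup.Normal.conj_mem inferInstance w hwK _))
  have hS := hconj 0
  have hT := hconj 1
  simp only [map_mul, map_inv, Units.val_mul, rhoST, FreeGroup.lift_apply_of] at hS hT
  change Matrix.trace ((rhoST w).val * (Sgl.val * (rhoST w).val * Sgl⁻¹.val)) = 2 at hS
  change Matrix.trace ((rhoST w).val * (Tgl.val * (rhoST w).val * Tgl⁻¹.val)) = 2 at hT
  apply hne
  apply Units.ext
  generalize (rhoST w).val = V at *
  rw [Matrix.eta_fin_two V] at *
  generalize V 0 0 = a at *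
  generalize V 0 1 = b at *
  generalize V 1 0 = c at *
  generalize V 1 1 = d at *
  simp [Sgl, Tgl, Matrix.trace_fin_two, Matrix.det_fin_two] at hS hT htr hdet
  have hc : c = 0 := by
    obtain rfl : d = 2 - a := by linarith
    have : c ^ 2 = 0 := by nlinarith
    simpa using this
  have hb : b = 0 := by
    obtain rfl : d = 2 - a := by linarith
    have : b ^ 2 = 0 := by nlinarith
    simpa using this
  have ha : a = 1 := by
    obtain rfl : d = 2 - a := by linarith
    subst hc hb
    have : (a - 1) ^ 2 = 0 := by linarith
    have := pow_eq_zero_iff (two_ne_zero) |>.mp this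
    linarith
  have hd : d = 1 := by linarith
  simp [ha, hb, hc, hd, Matrix.one_fin_two]

/-- Every element of `GL(2,ℤ)` has a power in the Sanov subgroup, with a uniform exponent. -/
theorem pow_mem_range_rhoST (g : Matrix.GeneralLinearGroup (Fin 2) ℤ) :
    g ^ (2 * Nat.card (Matrix.GeneralLinearGroup (Fin 2) (ZMod 4))) ∈ rhoST.range := by
  set m := Nat.card (Matrix.GeneralLinearGroup (Fin 2) (ZMod 4))
  have hmod : Matrix.GeneralLinearGroup.map (Int.castRingHom (ZMod 4)) (g ^ (2 * m)) = 1 := by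
    rw [map_pow, mul_comm, pow_mul, pow_card_eq_one', one_pow]
  have hdet : (g ^ (2 * m)).val.det = 1 := by
    rw [Units.val_pow_eq_pow_val, Matrix.det_pow, pow_mul]
    have := (Matrix.isUnit_iff_isUnit_det g.val).mp g.isUnit
    rcases Int.isUnit_iff.mp this with h | h <;> simp [h]
  generalize g ^ (2 * m) = c at hmod hdet ⊢
  have hentry : ∀ i j, ((c i j : ℤ) : ZMod 4) = ((if i = j then 1 else 0 : ℤ) : ZMod 4) := by
    intro i j
    simpa [Matrix.one_apply] using congrArg
      (fun x : Matrix.GeneralLinearGroup (Fin 2) (ZMod 4) => x i j) hmod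
  have hdvd : ∀ i j, (4 : ℤ) ∣ (if i = j then 1 else 0) - c i j := fun i j =>
    (ZMod.intCast_eq_intCast_iff_dvd_sub _ _ 4).mp (hentry i j)
  have h00 := hdvd 0 0
  have h01 := hdvd 0 1
  have h10 := hdvd 1 0
  simp only [if_true, zero_ne_one, one_ne_zero, if_false] at h00 h01 h10
  exact mem_range_rhoST c hdet (by omega) (by omega) (by omega)

/-- The block-diagonal embedding `GL(2,ℤ) × GL(2,ℤ) → GL(4,ℤ)`. -/
def blockDiagGL : Matrix.GeneralLinearGroup (Fin 2) ℤ × Matrix.GeneralLinearGroup (Fin 2) ℤ →*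
    Matrix.GeneralLinearGroup (Fin 4) ℤ :=
  (Units.map blockDiagHom.toMonoidHom).comp MulEquiv.prodUnits.symm.toMonoidHom

theorem iotaSTD_apply (u v : FreeGroup (Fin 2)) :
    iotaSTD (u, v) = blockDiagGL (rhoST u, rhoST v) := rfl

theorem coe_iotaSTD (u v : FreeGroup (Fin 2)) :
    (iotaSTD (u, v)).val = blockDiagHom ((rhoST u).val, (rhoST v).val) := rfl

theorem blockDiagHom_apply (X W : Matrix (Fin 2) (Fin 2) ℤ) :
    blockDiagHom (X, W) = Matrix.reindexRingEquiv ℤ finSumFinEquiv (Matrix.fromBlocks X 0 0 W) :=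
  rfl

theorem blockDiagHom_injective : Function.Injective blockDiagHom := by
  rintro ⟨X, W⟩ ⟨X', W'⟩ h
  rw [blockDiagHom_apply, blockDiagHom_apply, EmbeddingLike.apply_eq_iff_eq,
    Matrix.fromBlocks_inj] at h
  exact Prod.ext h.1 h.2.2.2

theorem trace_blockDiagHom (X W : Matrix (Fin 2) (Fin 2) ℤ) :
    (blockDiagHom (X, W)).trace = X.trace + W.trace := by
  have h : (blockDiagHom (X, W)).trace = (Matrix.fromBlocks X 0 0 W).trace :=
    Equiv.sum_comp finSumFinEquiv.symm (Matrix.fromBlocks X 0 0 W).diag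
  rw [h, Matrix.trace]
  simp [Fintype.sum_sum_type, Matrix.trace]

theorem det_blockDiagHom (X W : Matrix (Fin 2) (Fin 2) ℤ) :
    (blockDiagHom (X, W)).det = X.det * W.det := by
  rw [← Matrix.det_fromBlocks_zero₂₁ X 0 W]
  exact Matrix.det_submatrix_equiv_self _ _

theorem iotaSTD_injective : Function.Injective iotaSTD := by
  rintro ⟨u, v⟩ ⟨u', v'⟩ h
  have h' := congrArg Units.val h
  rw [coe_iotaSTD, coe_iotaSTD] at h'
  have h'' := Prod.ext_iff.mp (blockDiagHom_injective h')
  exact Prod.ext (rhoST_injective (Units.ext h''.1)) (rhoST_injective (Units.ext h''.2))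

theorem exists_blockDiagGL_eq {A : Matrix.GeneralLinearGroup (Fin 4) ℤ}
    {X W : Matrix (Fin 2) (Fin 2) ℤ} (h : A.val = blockDiagHom (X, W)) :
    ∃ B, A = blockDiagGL B := by
  have hdet := (Matrix.isUnit_iff_isUnit_det A.val).mp A.isUnit
  rw [h, det_blockDiagHom, IsUnit.mul_iff, ← Matrix.isUnit_iff_isUnit_det,
    ← Matrix.isUnit_iff_isUnit_det] at hdet
  obtain ⟨⟨x, hx⟩, ⟨w, hw⟩⟩ := hdet
  subst hx hw
  exact ⟨(x, w), Units.ext h⟩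

theorem Matrix.mul_self_fin_two_of_det_eq_one {V : Matrix (Fin 2) (Fin 2) ℤ} (hV : V.det = 1) :
    V * V = V.trace • V - 1 := by
  rw [Matrix.det_fin_two] at hV
  ext i j
  fin_cases i <;> fin_cases j <;>
    simp [Matrix.mul_apply, Matrix.trace_fin_two, -zsmul_eq_mul] <;> linarith

theorem Matrix.eq_one_or_trace_eq {V : Matrix (Fin 2) (Fin 2) ℤ} (hV : V.det = 1) {τ : ℤ}
    (h : (V - 1) * (V * V - τ • V + 1) = 0) : V = 1 ∨ V.trace = τ := by
  rw [mul_self_fin_two_of_det_eq_one hV] at h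
  have h1 : (V.trace - τ) • ((V - 1) * V) = 0 := by
    rw [← h, ← Matrix.mul_smul]
    congr 1
    module
  rcases smul_eq_zero.mp h1 with h2 | h2
  · exact Or.inr (sub_eq_zero.mp h2)
  · refine Or.inl (sub_eq_zero.mp ?_)
    have hu : IsUnit V := (Matrix.isUnit_iff_isUnit_det V).mpr (by simp [hV])
    exact hu.mul_left_eq_zero.mp h2

theorem Matrix.det_sub_one_ne_zero {V : Matrix (Fin 2) (Fin 2) ℤ} (hV : V.det = 1)
    (h : V.trace ≠ 2) : (V - 1).det ≠ 0 := by
  intro h0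
  rw [Matrix.det_fin_two] at hV h0
  rw [Matrix.trace_fin_two] at h
  simp at h0
  apply h
  linarith

theorem Matrix.eq_zero_of_mul_eq_left {V Y : Matrix (Fin 2) (Fin 2) ℤ} (hV : V.det = 1)
    (h : V.trace ≠ 2) (hY : V * Y = Y) : Y = 0 := by
  have h0 : (V - 1) * Y = 0 := by rw [sub_mul, hY, one_mul, sub_self]
  have h1 := congrArg ((V - 1).adjugate * ·) h0
  simp only [← mul_assoc, Matrix.adjugate_mul, Matrix.smul_mul, one_mul, mul_zero] at h1
  exact (smul_eq_zero.mp h1).resolve_left (det_sub_one_ne_zero hV h)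

theorem Matrix.eq_zero_of_mul_eq_right {V Y : Matrix (Fin 2) (Fin 2) ℤ} (hV : V.det = 1)
    (h : V.trace ≠ 2) (hY : Y * V = Y) : Y = 0 := by
  refine Matrix.transpose_eq_zero.mp (eq_zero_of_mul_eq_left (V := V.transpose) ?_ ?_ ?_)
  · rwa [Matrix.det_transpose]
  · rwa [Matrix.trace_transpose]
  · rw [← Matrix.transpose_mul, hY]

/-- If `A` conjugates some `ι(n,1)` with `ρ(n)` not unipotent into the image of `ι`, then `A`
preserves or exchanges the two blocks; in either case `A²` is block diagonal. -/
theorem exists_sq_eq_blockDiagGL {A : Matrix.GeneralLinearGroup (Fin 4) ℤ}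
    {n u v : FreeGroup (Fin 2)} (hn : (rhoST n).val.trace ≠ 2)
    (hA : A * iotaSTD (n, 1) * A⁻¹ = iotaSTD (u, v)) : ∃ B, A ^ 2 = blockDiagGL B := by
  have hmul : A.val * blockDiagHom ((rhoST n).val, 1) =
      blockDiagHom ((rhoST u).val, (rhoST v).val) * A.val := by
    have := congrArg Units.val (mul_inv_eq_iff_eq_mul.mp hA)
    simpa [coe_iotaSTD] using this
  have hN := det_rhoST n
  have hU := det_rhoST u
  have hV := det_rhoST v
  generalize (rhoST n).val = N at *
  generalize (rhoST u).val = U at *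
  generalize (rhoST v).val = V at *
  have htr : U.trace + V.trace = N.trace + 2 := by
    rw [← trace_blockDiagHom, ← mul_one (blockDiagHom (U, V)), ← Units.mul_inv A, ← mul_assoc,
      ← hmul, Matrix.trace_mul_comm, ← mul_assoc, Units.inv_mul, one_mul, trace_blockDiagHom]
    simp
  have hpoly : ((U, V) - 1) * ((U, V) * (U, V) - N.trace • (U, V) + 1) = 0 := by
    have hN0 : ((N, 1) - 1) * ((N, 1) * (N, 1) - N.trace • (N, 1) + 1) =
        (0 : Matrix (Fin 2) (Fin 2) ℤ × Matrix (Fin 2) (Fin 2) ℤ) := by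
      ext1
      · simp [Matrix.mul_self_fin_two_of_det_eq_one hN]
      · simp
    apply blockDiagHom_injective
    rw [map_zero, ← A.isUnit.mul_left_eq_zero]
    have hN1 := congrArg (A.val * blockDiagHom ·) hN0
    simp only [map_mul, map_sub, map_add, map_one, map_zero, map_zsmul] at hN1 ⊢
    generalize blockDiagHom (U, V) = k at *
    generalize blockDiagHom (N, 1) = g at *
    have e1 : (k - 1) * A.val = A.val * (g - 1) := by
      rw [sub_mul, mul_sub, hmul, one_mul, mul_one]
    have e2 : (k * k - N.trace • k + 1) * A.val = A.val * (g * g - N.trace • g + 1) := by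
      rw [add_mul, sub_mul, mul_add, mul_sub, mul_assoc, ← hmul, ← mul_assoc, ← hmul, mul_assoc,
        smul_mul_assoc, mul_smul_comm, hmul, one_mul, mul_one]
    rw [mul_assoc, e2, ← mul_assoc, e1, mul_assoc, hN1, mul_zero]
  have hUcase : U = 1 ∨ U.trace = N.trace :=
    Matrix.eq_one_or_trace_eq hU (congrArg Prod.fst hpoly)
  have hVcase : V = 1 ∨ V.trace = N.trace :=
    Matrix.eq_one_or_trace_eq hV (congrArg Prod.snd hpoly)
  obtain ⟨A', hA'⟩ := (Matrix.reindexRingEquiv ℤ (finSumFinEquiv (m := 2) (n := 2))).surjective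
    A.val
  rw [← hA', blockDiagHom_apply, blockDiagHom_apply, ← map_mul, ← map_mul,
    EmbeddingLike.apply_eq_iff_eq, ← Matrix.fromBlocks_toBlocks A'] at hmul
  simp only [Matrix.fromBlocks_multiply, Matrix.fromBlocks_inj, mul_zero, zero_mul, add_zero,
    zero_add, mul_one] at hmul
  obtain ⟨h11, h12, h21, h22⟩ := hmul
  have hsq : ∃ X W, A' * A' = Matrix.fromBlocks X 0 0 W := by
    by_cases hV1 : V = 1
    · subst hV1
      have hUN : U.trace ≠ 2 := by
        simp at htr
        omega
      have hY := Matrix.eq_zero_of_mul_eq_left hU hUN h12.symm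
      have hZ := Matrix.eq_zero_of_mul_eq_right hN hn (h21.trans (one_mul _))
      refine ⟨A'.toBlocks₁₁ * A'.toBlocks₁₁, A'.toBlocks₂₂ * A'.toBlocks₂₂, ?_⟩
      conv_lhs => rw [← Matrix.fromBlocks_toBlocks A', hY, hZ, Matrix.fromBlocks_multiply]
      simp only [mul_zero, zero_mul, add_zero, zero_add]
    · have hVN := hVcase.resolve_left hV1
      have hU1 : U = 1 := hUcase.resolve_right (by omega)
      subst hU1
      have hX := Matrix.eq_zero_of_mul_eq_right hN hn (h11.trans (one_mul _))
      have hW := Matrix.eq_zero_of_mul_eq_left hV (hVN ▸ hn) h22.symm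
      refine ⟨A'.toBlocks₁₂ * A'.toBlocks₂₁, A'.toBlocks₂₁ * A'.toBlocks₁₂, ?_⟩
      conv_lhs => rw [← Matrix.fromBlocks_toBlocks A', hX, hW, Matrix.fromBlocks_multiply]
      simp only [mul_zero, zero_mul, add_zero, zero_add]
  obtain ⟨X, W, hXW⟩ := hsq
  refine exists_blockDiagGL_eq (X := X) (W := W) ?_
  rw [sq, Units.val_mul, ← hA', ← map_mul, hXW, blockDiagHom_apply]

/-- Under the same hypothesis, some positive power of `A` lies in the image of `ι`. -/
theorem exists_pow_eq_iotaSTD {A : Matrix.GeneralLinearGroup (Fin 4) ℤ}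
    {n u v : FreeGroup (Fin 2)} (hn : (rhoST n).val.trace ≠ 2)
    (hA : A * iotaSTD (n, 1) * A⁻¹ = iotaSTD (u, v)) :
    ∃ k, 0 < k ∧ ∃ b, A ^ k = iotaSTD b := by
  obtain ⟨⟨B, C⟩, hBC⟩ := exists_sq_eq_blockDiagGL hn hA
  obtain ⟨b, hb⟩ := pow_mem_range_rhoST B
  obtain ⟨c, hc⟩ := pow_mem_range_rhoST C
  refine ⟨2 * (2 * Nat.card (Matrix.GeneralLinearGroup (Fin 2) (ZMod 4))), ?_, (b, c), ?_⟩
  · have : 0 < Nat.card (Matrix.GeneralLinearGroup (Fin 2) (ZMod 4)) := Nat.card_pos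
    omega
  · rw [pow_mul, hBC, ← map_pow, Prod.pow_mk, iotaSTD_apply, hb, hc]

/-- A subgroup containing the Mihailova subgroup `L` which is conjugated into `L` by an element of
`GL(4,ℤ)` equals `L`. -/
theorem le_mihailova_of_conj {H : Type*} [Group H] {π : FreeGroup (Fin 2) →* H}
    (hker : π.ker ≠ ⊥) {M : Subgroup (FreeGroup (Fin 2) × FreeGroup (Fin 2))}
    (hLM : mihailova π ≤ M) {A : Matrix.GeneralLinearGroup (Fin 4) ℤ}
    (hA : ∀ x ∈ M, ∃ y ∈ mihailova π, A * iotaSTD x * A⁻¹ = iotaSTD y) : M ≤ mihailova π := by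
  have hpow : ∀ k : ℕ, ∀ x ∈ M, ∃ y ∈ mihailova π,
      A ^ (k + 1) * iotaSTD x * (A ^ (k + 1))⁻¹ = iotaSTD y := by
    intro k
    induction k with
    | zero => simpa using hA
    | succ k ih =>
      intro x hx
      obtain ⟨y, hy, hxy⟩ := ih x hx
      obtain ⟨z, hz, hyz⟩ := hA y (hLM hy)
      refine ⟨z, hz, ?_⟩
      rw [← hyz, ← hxy, pow_succ' A (k + 1)]
      group
  obtain ⟨n, hnK, hn⟩ := exists_mem_trace_rhoST_ne_two hker
  have hnL : (n, 1) ∈ mihailova π := show π n = π 1 by rw [MonoidHom.mem_ker.mp hnK, map_one]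
  obtain ⟨⟨u, v⟩, -, huv⟩ := hA _ (hLM hnL)
  obtain ⟨k, hk, ⟨b, c⟩, hbc⟩ := exists_pow_eq_iotaSTD hn huv
  rintro ⟨x, y⟩ hxy
  have hM : (x * y⁻¹, (1 : FreeGroup (Fin 2))) ∈ M := by
    have hyy : (y, y) ∈ M := hLM (show π y = π y from rfl)
    simpa using M.mul_mem hxy (M.inv_mem hyy)
  obtain ⟨z, hz, hxz⟩ := hpow (k - 1) _ hM
  rw [Nat.sub_add_cancel hk, hbc, ← map_inv, ← map_mul, ← map_mul] at hxz
  rw [← iotaSTD_injective hxz] at hz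
  have hz' : π (b * (x * y⁻¹) * b⁻¹) = π (c * 1 * c⁻¹) := hz
  have hxy1 : π x * (π y)⁻¹ = 1 := by simpa using hz'
  exact mul_inv_eq_one.mp hxy1

/-- The isomorphism `GL(4,ℤ) ≃ Aut(ℤ⁴)`. -/
def glAutEquiv : Matrix.GeneralLinearGroup (Fin 4) ℤ ≃* MulAut (Multiplicative (Fin 4 → ℤ)) where
  toFun := glAut
  invFun A := Matrix.GeneralLinearGroup.toLin.symm
    ((LinearMap.GeneralLinearGroup.generalLinearEquiv ℤ (Fin 4 → ℤ)).symm
      (AddEquiv.toMultiplicative.symm A).toIntLinearEquiv)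
  left_inv g := by
    rw [MulEquiv.symm_apply_eq, MulEquiv.symm_apply_eq]
    ext
    rfl
  right_inv A := by
    ext x
    simp [glAut]
  map_mul' g k := by
    ext x
    simp [glAut]

theorem glAutEquiv_apply (g : Matrix.GeneralLinearGroup (Fin 4) ℤ) : glAutEquiv g = glAut g := rfl

section actionOf

variable {p : ℕ} (hs : Fin p → Matrix.GeneralLinearGroup (Fin 4) ℤ)
  (k : MulAut (Multiplicative (Fin 4 → ℤ)))

theorem actionOf_of_castSucc (i : Fin p) :
    actionOf p hs k (FreeGroup.of i.castSucc) = glAut (hs i) := by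
  simp [actionOf]

theorem actionOf_of_last : actionOf p hs k (FreeGroup.of (Fin.last p)) = k := by
  simp [actionOf]

theorem actionOf_map_castSucc (w : FreeGroup (Fin p)) :
    actionOf p hs k (FreeGroup.map Fin.castSucc w) = glAut (FreeGroup.lift hs w) := by
  have h : (actionOf p hs k).comp (FreeGroup.map Fin.castSucc) =
      glAutEquiv.toMonoidHom.comp (FreeGroup.lift hs) := by
    ext1 i
    simp [actionOf_of_castSucc, glAutEquiv_apply]
  exact DFunLike.congr_fun h w

theorem range_actionOf_one_le :
    (actionOf p hs 1).range ≤ (Subgroup.closure (Set.range hs)).map glAutEquiv.toMonoidHom := by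
  rw [actionOf, FreeGroup.range_lift_eq_closure, Subgroup.closure_le]
  rintro _ ⟨i, rfl⟩
  dsimp only
  split_ifs with hi
  · exact ⟨_, Subgroup.subset_closure ⟨_, rfl⟩, rfl⟩
  · exact one_mem _

end actionOf

/-- The endomorphism of a free group multiplying the last generator on the left by a word in the
others, and fixing the others. -/
def FreeGroup.transvection {p : ℕ} (w : FreeGroup (Fin p)) :
    FreeGroup (Fin (p + 1)) →* FreeGroup (Fin (p + 1)) :=
  FreeGroup.lift (Fin.lastCases (FreeGroup.map Fin.castSucc w * FreeGroup.of (Fin.last p))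
    fun i => FreeGroup.of i.castSucc)

theorem FreeGroup.transvection_of_castSucc {p : ℕ} (w : FreeGroup (Fin p)) (i : Fin p) :
    transvection w (of i.castSucc) = of i.castSucc := by
  simp [transvection]

theorem FreeGroup.transvection_of_last {p : ℕ} (w : FreeGroup (Fin p)) :
    transvection w (of (Fin.last p)) = map Fin.castSucc w * of (Fin.last p) := by
  simp [transvection]

theorem FreeGroup.transvection_map_castSucc {p : ℕ} (w v : FreeGroup (Fin p)) :
    transvection w (map Fin.castSucc v) = map Fin.castSucc v := by
  have h : (transvection w).comp (map Fin.castSucc) = map Fin.castSucc := by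
    ext1 i
    simp [transvection_of_castSucc]
  exact DFunLike.congr_fun h v

theorem FreeGroup.transvection_comp_of_mul_eq_one {p : ℕ} {v w : FreeGroup (Fin p)}
    (h : v * w = 1) :
    (transvection w).comp (transvection v) = MonoidHom.id _ := by
  ext1 i
  cases i using Fin.lastCases with
  | last =>
    simp only [MonoidHom.comp_apply, transvection_of_last, _root_.map_mul,
      transvection_map_castSucc, ← mul_assoc]
    rw [← _root_.map_mul, h, _root_.map_one, one_mul, MonoidHom.id_apply]
  | cast i => simp [transvection_of_castSucc]

/-- `FreeGroup.transvection` as an automorphism. -/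
def FreeGroup.transvectionEquiv {p : ℕ} (w : FreeGroup (Fin p)) :
    FreeGroup (Fin (p + 1)) ≃* FreeGroup (Fin (p + 1)) :=
  (transvection w).toMulEquiv (transvection w⁻¹)
    (transvection_comp_of_mul_eq_one (mul_inv_cancel w))
    (transvection_comp_of_mul_eq_one (inv_mul_cancel w))

theorem actionOf_comp_transvection {p : ℕ} (hs : Fin p → Matrix.GeneralLinearGroup (Fin 4) ℤ)
    (w : FreeGroup (Fin p)) :
    (actionOf p hs 1).comp (FreeGroup.transvection w) =
      actionOf p hs (glAut (FreeGroup.lift hs w)) := by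
  ext1 i
  cases i using Fin.lastCases with
  | last =>
    simp [FreeGroup.transvection_of_last, actionOf_map_castSucc, actionOf_of_last]
  | cast i => simp [FreeGroup.transvection_of_castSucc, actionOf_of_castSucc]

theorem mem_mihailova_iff_semidirect_products_isomorphic
    (H : Type*) [Group H] (π : FreeGroup (Fin 2) →* H)
    (hπ : Function.Surjective π) (hker : π.ker ≠ ⊥)
    (p : ℕ) (hp : 1 ≤ p) (hs : Fin p → Matrix.GeneralLinearGroup (Fin 4) ℤ)
    (hgen : Subgroup.closure (Set.range hs) = (mihailova π).map iotaSTD)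
    (h : FreeGroup (Fin 2) × FreeGroup (Fin 2)) :
    h ∈ mihailova π ↔
      Nonempty
        ((Multiplicative (Fin 4 → ℤ) ⋊[actionOf p hs (glAut (iotaSTD h))]
            FreeGroup (Fin (p + 1))) ≃*
          (Multiplicative (Fin 4 → ℤ) ⋊[actionOf p hs 1] FreeGroup (Fin (p + 1)))) := by
  have hword : ∀ x ∈ mihailova π, ∃ w, FreeGroup.lift hs w = iotaSTD x := by
    intro x hx
    have : iotaSTD x ∈ (FreeGroup.lift hs).range := by
      rw [FreeGroup.range_lift_eq_closure, hgen]
      exact ⟨x, hx, rfl⟩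
    exact this
  constructor
  · intro hL
    obtain ⟨w, hw⟩ := hword h hL
    refine ⟨SemidirectProduct.congr (MulEquiv.refl _) (FreeGroup.transvectionEquiv w) fun f => ?_⟩
    rw [← hw, ← actionOf_comp_transvection]
    rfl
  · rintro ⟨φ⟩
    have : Nontrivial (Fin (p + 1)) := Fin.nontrivial_iff_two_le.mpr (by omega)
    obtain ⟨A', hA'⟩ := SemidirectProduct.exists_mulAut_conj_of_mulEquiv φ
    obtain ⟨A, rfl⟩ := glAutEquiv.surjective A'
    let M := (actionOf p hs (glAut (iotaSTD h))).range.comap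
      (glAutEquiv.toMonoidHom.comp iotaSTD)
    have hLM : mihailova π ≤ M := by
      intro x hx
      obtain ⟨w, hw⟩ := hword x hx
      exact ⟨FreeGroup.map Fin.castSucc w, by rw [actionOf_map_castSucc, hw]; rfl⟩
    refine le_mihailova_of_conj hker hLM (A := A) ?_ (x := h)
      ⟨FreeGroup.of (Fin.last p), actionOf_of_last _ _⟩
    rintro x ⟨f, hf⟩
    obtain ⟨g, hg, hgA⟩ := range_actionOf_one_le hs (hA' f)
    rw [hgen] at hg
    obtain ⟨y, hy, rfl⟩ := hg
    refine ⟨y, hy, glAutEquiv.injective ?_⟩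
    rw [hf] at hgA
    simpa using hgA.symm
end
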